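/- Let N ≥ 2, let L be an N×N Laplacian matrix of a nonnegatively weighted directed graph, and let L̃ be its reduced matrix. Then the zero eigenvalue of L̃ is semisimple: ker(L̃·L̃) = ker(L̃). -/

import Mathlib

/-- An `N × N` real matrix is a Laplacian matrix of a nonnegatively weighted directed
graph: all off-diagonal entries are nonpositive and every row sums to zero. -/
def IsLaplacian {N : ℕ} (L : Matrix (Fin N) (Fin N) ℝ) : Prop :=
  (∀ i j, i ≠ j → L i j ≤ 0) ∧ (∀ i, ∑ j, L i j = 0)

/-- The involutive matrix `Δ` (here for `N = m + 2`): its first row is `e₁`, and its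
`i`-th row for `i ≥ 2` is `e₁ − e_i`. -/
def Delta (m : ℕ) : Matrix (Fin (m + 2)) (Fin (m + 2)) ℝ :=
  fun i j => if j = 0 then 1 else if j = i then -1 else 0

/-- The reduced matrix `L̃`: the lower-right `(N−1) × (N−1)` block of `Δ L Δ`. -/
def reduced {m : ℕ} (L : Matrix (Fin (m + 2)) (Fin (m + 2)) ℝ) :
    Matrix (Fin (m + 1)) (Fin (m + 1)) ℝ :=
  fun i j => (Delta m * L * Delta m) i.succ j.succ

namespace IsLaplacian

open Matrix

variable {N : ℕ} {L : Matrix (Fin N) (Fin N) ℝ}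

theorem mulVec_apply (hL : IsLaplacian L) (x : Fin N → ℝ) (i : Fin N) :
    (L *ᵥ x) i = ∑ j, L i j * (x j - x i) := by
  simp [mul_sub, Finset.sum_sub_distrib, ← Finset.sum_mul, hL.2 i, mulVec, dotProduct]

theorem mulVec_const (hL : IsLaplacian L) (c : ℝ) : L *ᵥ (fun _ => c) = 0 := by
  ext i
  simp [hL.mulVec_apply]

/-- On a nonempty set of vertices closed under out-edges, `L x` is nonpositive somewhere. -/
theorem exists_mulVec_nonpos (hL : IsLaplacian L) (x : Fin N → ℝ) {S : Finset (Fin N)}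
    (hS : S.Nonempty) (hclosed : ∀ i ∈ S, ∀ j ∉ S, L i j = 0) :
    ∃ i ∈ S, (L *ᵥ x) i ≤ 0 := by
  obtain ⟨i, hi, hmin⟩ := S.exists_min_image x hS
  refine ⟨i, hi, ?_⟩
  rw [hL.mulVec_apply]
  refine Finset.sum_nonpos fun j _ => ?_
  by_cases hj : j ∈ S
  · rcases eq_or_ne i j with rfl | hij
    · simp
    · exact mul_nonpos_of_nonpos_of_nonneg (hL.1 i j hij) (sub_nonneg.2 (hmin j hj))
  · simp [hclosed i hi j hj]

/-- The maximum set of a vector in the kernel of `L` is closed under out-edges. -/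
theorem apply_eq_zero_of_mulVec_eq_zero (hL : IsLaplacian L) {z : Fin N → ℝ}
    (hz : L *ᵥ z = 0) {i : Fin N} (hmax : ∀ j, z j ≤ z i) {j : Fin N} (hj : z j ≠ z i) :
    L i j = 0 := by
  have hsum := hL.mulVec_apply z i
  rw [hz, Pi.zero_apply, eq_comm, Finset.sum_eq_zero_iff_of_nonneg] at hsum
  · exact (mul_eq_zero.1 (hsum j (Finset.mem_univ j))).resolve_right (sub_ne_zero.2 hj)
  · intro k _
    rcases eq_or_ne i k with rfl | hik
    · simp
    · exact mul_nonneg_of_nonpos_of_nonpos (hL.1 i k hik) (sub_nonpos.2 (hmax k))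

theorem mulVec_nonpos (hL : IsLaplacian L) {x : Fin N → ℝ} (hx : L *ᵥ (L *ᵥ x) = 0)
    (i : Fin N) : (L *ᵥ x) i ≤ 0 := by
  obtain ⟨k, -, hk⟩ := Finset.univ.exists_max_image (L *ᵥ x) ⟨i, Finset.mem_univ i⟩
  have hmax : ∀ j, (L *ᵥ x) j ≤ (L *ᵥ x) k := fun j => hk j (Finset.mem_univ j)
  obtain ⟨l, hl, hle⟩ := hL.exists_mulVec_nonpos x
    (S := {l | (L *ᵥ x) l = (L *ᵥ x) k}) ⟨k, by simp⟩ (by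
      intro a ha b hb
      simp only [Finset.mem_filter_univ] at ha hb
      exact hL.apply_eq_zero_of_mulVec_eq_zero hx (ha ▸ hmax) (ha ▸ hb))
  simp only [Finset.mem_filter_univ] at hl
  linarith [hmax i]

theorem mulVec_eq_zero_of_mulVec_mulVec_eq_zero (hL : IsLaplacian L) {x : Fin N → ℝ}
    (hx : L *ᵥ (L *ᵥ x) = 0) : L *ᵥ x = 0 := by
  ext i
  refine le_antisymm (hL.mulVec_nonpos hx i) ?_
  have h := hL.mulVec_nonpos (x := -x) (by simp [mulVec_neg, hx]) i
  simpa [mulVec_neg] using h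

/-- A nonzero constant vector is not in the range of a Laplacian matrix. -/
theorem eq_zero_of_mulVec_eq_const [NeZero N] (hL : IsLaplacian L) {z : Fin N → ℝ} {c : ℝ}
    (hz : L *ᵥ z = fun _ => c) : c = 0 := by
  obtain ⟨i, -, hi⟩ := hL.exists_mulVec_nonpos z Finset.univ_nonempty (by simp)
  obtain ⟨j, -, hj⟩ := hL.exists_mulVec_nonpos (-z) Finset.univ_nonempty (by simp)
  simp only [mulVec_neg, hz, Pi.neg_apply] at hi hj
  linarith

end IsLaplacian

open Matrix in
theorem reduced_mulVec {m : ℕ} (L : Matrix (Fin (m + 2)) (Fin (m + 2)) ℝ)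
    (y : Fin (m + 1) → ℝ) (i : Fin (m + 1)) :
    (reduced L *ᵥ y) i =
      (L *ᵥ (Fin.cons 0 y : Fin (m + 2) → ℝ)) i.succ -
        (L *ᵥ (Fin.cons 0 y : Fin (m + 2) → ℝ)) 0 := by
  have happly : ∀ j, reduced L i j = L i.succ j.succ - L 0 j.succ := fun j => by
    simp [reduced, Delta, mul_apply, Fin.sum_univ_succ (n := m + 1), sub_eq_add_neg]
  simp [mulVec, dotProduct, happly, Fin.sum_univ_succ (n := m + 1), sub_mul,
    Finset.sum_sub_distrib]

open Matrix in
/-- `L̃` is the map induced by `L` modulo constant vectors. -/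
theorem cons_reduced_mulVec {m : ℕ} (L : Matrix (Fin (m + 2)) (Fin (m + 2)) ℝ)
    (y : Fin (m + 1) → ℝ) :
    (Fin.cons 0 (reduced L *ᵥ y) : Fin (m + 2) → ℝ) =
      L *ᵥ (Fin.cons 0 y : Fin (m + 2) → ℝ) -
        fun _ => (L *ᵥ (Fin.cons 0 y : Fin (m + 2) → ℝ)) 0 := by
  ext i
  refine Fin.cases ?_ (fun j => ?_) i
  · simp
  · simp [reduced_mulVec]

/-- For a Laplacian matrix `L` of size `N = m + 2 ≥ 2`, the zero eigenvalue of the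
reduced matrix `L̃` is semisimple: `ker (L̃ * L̃) = ker L̃`. -/
theorem reduced_laplacian_zero_semisimple {m : ℕ}
    (L : Matrix (Fin (m + 2)) (Fin (m + 2)) ℝ) (hL : IsLaplacian L) :
    LinearMap.ker (Matrix.toLin' (reduced L * reduced L)) =
      LinearMap.ker (Matrix.toLin' (reduced L)) := by
  ext y
  simp only [LinearMap.mem_ker, Matrix.toLin'_apply, ← Matrix.mulVec_mulVec]
  refine ⟨fun h => ?_, fun h => by rw [h, Matrix.mulVec_zero]⟩
  have hsq := cons_reduced_mulVec L (Matrix.mulVec (reduced L) y)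
  rw [h, cons_reduced_mulVec, Matrix.mulVec_sub, hL.mulVec_const, sub_zero,
    show (Fin.cons 0 0 : Fin (m + 2) → ℝ) = 0 from Matrix.cons_zero_zero, eq_comm,
    sub_eq_zero] at hsq
  have hzero := hL.mulVec_eq_zero_of_mulVec_mulVec_eq_zero
    (hsq.trans (by rw [hL.eq_zero_of_mulVec_eq_const hsq]; rfl))
  ext i
  simp [reduced_mulVec, hzero]
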